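/- Let $i$ be a non-negative integer and $P_i = \bigcup_{j < i} \operatorname{Supp}(H^j_I(N))$. Then $\operatorname{Ass}(H^i_I(N)) \cup P_i = \operatorname{Ass}(\operatorname{Ext}^i_R(R/I, N)) \cup P_i$. In particular, for $r = \operatorname{gdepth}(I, N)$, the set $\operatorname{Ass}(H^r_I(N))$ of associated primes is finite. -/

import Mathlib

open Opposite CategoryTheory CategoryTheory.Limits TensorProduct

noncomputable section

universe u

/-- `M/IM` as an object of `ModuleCat R`. -/
def modQuot {R : Type u} [CommRing R] (I : Ideal R) (M : ModuleCat.{u} R) : ModuleCat.{u} R :=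
  ModuleCat.of R (M ⧸ (I • ⊤ : Submodule R M))

/-- The Ext module `Ext^j_R(A, B)`. -/
def extMod {R : Type u} [CommRing R] (j : ℕ) (A B : ModuleCat.{u} R) : ModuleCat.{u} R :=
  ((Ext R (ModuleCat.{u} R) j).obj (op A)).obj B

/-- `xs` is a generalized regular sequence of `N` in `J`: each `xⱼ` lies in `J` and avoids all
associated primes `p` of `N/(x₁,...,xⱼ₋₁)N` with `dim(R/p) ≥ 2`. -/
def IsGenRegSeq {R : Type u} [CommRing R] (J : Ideal R) (N : ModuleCat.{u} R)
    (xs : List R) : Prop :=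
  (∀ x ∈ xs, x ∈ J) ∧
  ∀ i : Fin xs.length, ∀ p ∈ associatedPrimes R
      (N ⧸ (Ideal.span {x | x ∈ xs.take i.1} • (⊤ : Submodule R N))),
    (2 : WithBot ℕ∞) ≤ ringKrullDim (R ⧸ p) → xs.get i ∉ p

/-- The generalized depth of `N` in `J`: the supremum of the lengths of generalized regular
sequences of `N` in `J` (this is `+∞` when `dim(N/JN) ≤ 1`, and otherwise the common length
of all maximal generalized regular sequences of `N` in `J`). -/
def gdepth {R : Type u} [CommRing R] (J : Ideal R) (N : ModuleCat.{u} R) : ℕ∞ :=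
  sSup {n : ℕ∞ | ∃ xs : List R, IsGenRegSeq J N xs ∧ (xs.length : ℕ∞) = n}


/-! ### Auxiliary material -/

namespace GD

variable {R : Type u} [CommRing R]

/-- Every element is killed by an element outside `p`. -/
def SZ (p : Ideal R) (M : Type u) [AddCommGroup M] [Module R M] : Prop :=
  ∀ m : M, ∃ s : R, s ∉ p ∧ s • m = 0

variable (R) in
/-- The Ext modules (derived category version) for unbundled modules. -/
abbrev EE (M N : Type u) [AddCommGroup M] [Module R M] [AddCommGroup N] [Module R N] (j : ℕ) :=
  Abelian.Ext (ModuleCat.of R M) (ModuleCat.of R N) j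

variable {M M' M'' N N' N'' : Type u} [AddCommGroup M] [Module R M] [AddCommGroup M'] [Module R M']
  [AddCommGroup M''] [Module R M''] [AddCommGroup N] [Module R N] [AddCommGroup N'] [Module R N']
  [AddCommGroup N''] [Module R N'']

def pb (N : Type u) [AddCommGroup N] [Module R N] (f : M →ₗ[R] M') (j : ℕ) :
    EE R M' N j →ₗ[R] EE R M N j :=
  (Abelian.Ext.mk₀ (ModuleCat.ofHom f)).precompOfLinear R _ (zero_add j)

/-- Pushforward on Ext. -/
def pf (M : Type u) [AddCommGroup M] [Module R M] (f : N →ₗ[R] N') (j : ℕ) :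
    EE R M N j →ₗ[R] EE R M N' j :=
  (Abelian.Ext.mk₀ (ModuleCat.ofHom f)).postcompOfLinear R _ (add_zero j)

lemma pb_apply (f : M →ₗ[R] M') (j : ℕ) (α : EE R M' N j) :
    pb N f j α = (Abelian.Ext.mk₀ (ModuleCat.ofHom f)).comp α (zero_add j) := rfl

lemma pf_apply (f : N →ₗ[R] N') (j : ℕ) (α : EE R M N j) :
    pf M f j α = α.comp (Abelian.Ext.mk₀ (ModuleCat.ofHom f)) (add_zero j) := rfl

lemma pb_comp (f : M →ₗ[R] M') (g : M' →ₗ[R] M'') (j : ℕ) (α : EE R M'' N j) :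
    pb N (g ∘ₗ f) j α = pb N f j (pb N g j α) := by
  simp only [pb_apply, ModuleCat.ofHom_comp, Abelian.Ext.mk₀_comp_mk₀_assoc]

lemma pf_comp (f : N →ₗ[R] N') (g : N' →ₗ[R] N'') (j : ℕ) (α : EE R M N j) :
    pf M (g ∘ₗ f) j α = pf M g j (pf M f j α) := by
  simp only [pf_apply, ModuleCat.ofHom_comp, Abelian.Ext.comp_assoc_of_third_deg_zero,
    Abelian.Ext.mk₀_comp_mk₀]

lemma pb_id (j : ℕ) (α : EE R M N j) : pb N (LinearMap.id : M →ₗ[R] M) j α = α := by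
  simp only [pb_apply, ModuleCat.ofHom_id, Abelian.Ext.mk₀_id_comp]

lemma pf_id (j : ℕ) (α : EE R M N j) : pf M (LinearMap.id : N →ₗ[R] N) j α = α := by
  simp only [pf_apply, ModuleCat.ofHom_id, Abelian.Ext.comp_mk₀_id]

lemma pb_add (f g : M →ₗ[R] M') (j : ℕ) (α : EE R M' N j) :
    pb N (f + g) j α = pb N f j α + pb N g j α := by
  simp only [pb_apply, ModuleCat.ofHom_add, Abelian.Ext.mk₀_add, Abelian.Ext.add_comp]

lemma pb_zero (j : ℕ) (α : EE R M' N j) :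
    pb N (0 : M →ₗ[R] M') j α = 0 := by
  simp only [pb_apply, ModuleCat.ofHom_zero, Abelian.Ext.mk₀_zero, Abelian.Ext.zero_comp]

lemma pb_sum {ι : Type*} (s : Finset ι) (f : ι → (M →ₗ[R] M')) (j : ℕ) (α : EE R M' N j) :
    pb N (∑ a ∈ s, f a) j α = ∑ a ∈ s, pb N (f a) j α := by
  classical
  induction s using Finset.induction_on with
  | empty => simp [pb_zero]
  | insert a s ha ih => simp [Finset.sum_insert ha, pb_add, ih]

lemma pb_smul (r : R) (f : M →ₗ[R] M') (j : ℕ) (α : EE R M' N j) :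
    pb N (r • f) j α = r • pb N f j α := by
  have : ModuleCat.ofHom (r • f) = r • ModuleCat.ofHom f := rfl
  simp only [pb_apply, this, Abelian.Ext.mk₀_smul, Abelian.Ext.smul_comp]

lemma pf_smul (r : R) (f : N →ₗ[R] N') (j : ℕ) (α : EE R M N j) :
    pf M (r • f) j α = r • pf M f j α := by
  have : ModuleCat.ofHom (r • f) = r • ModuleCat.ofHom f := rfl
  simp only [pf_apply, this, Abelian.Ext.mk₀_smul, Abelian.Ext.comp_smul]

/-- An element killing `M` kills Ext. -/
lemma smul_EE_left (r : R) (h : ∀ m : M, r • m = 0) (j : ℕ) (α : EE R M N j) : r • α = 0 := by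
  have : r • (LinearMap.id : M →ₗ[R] M) = 0 := by ext m; simp [h]
  rw [← pb_id j α, ← pb_smul, this, pb_zero]

lemma smul_EE_right (r : R) (h : ∀ m : N, r • m = 0) (j : ℕ) (α : EE R M N j) : r • α = 0 := by
  have : r • (LinearMap.id : N →ₗ[R] N) = 0 := by ext m; simp [h]
  rw [← pf_id j α, ← pf_smul, this, pf_apply]
  simp only [ModuleCat.ofHom_zero, Abelian.Ext.mk₀_zero, Abelian.Ext.comp_zero]

lemma pb_exact (f : M →ₗ[R] M') (hf : Function.Surjective f) (j : ℕ) (α : EE R M N j)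
    (h : pb N (LinearMap.ker f).subtype j α = 0) : ∃ β, pb N f j β = α :=
  Abelian.Ext.contravariant_sequence_exact₂ (LinearMap.shortExact_shortComplexKer hf) _ α h

lemma pb_inj_zero (f : M →ₗ[R] M') (hf : Function.Surjective f) (α : EE R M' N 0)
    (h : pb N f 0 α = 0) : α = 0 := by
  have : Epi (ModuleCat.ofHom f) := (ModuleCat.epi_iff_surjective _).mpr hf
  apply Abelian.Ext.precomp_mk₀_injective_of_epi (ModuleCat.of R N) (ModuleCat.ofHom f)
  rw [map_zero]
  exact h

lemma pb_inj (p : Ideal R) (f : M →ₗ[R] M') (hf : Function.Surjective f)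
    (hp : p ≠ ⊤) (j : ℕ) (hS : ∀ l, l < j → SZ p (EE R (LinearMap.ker f) N l))
    (α : EE R M' N j)
    (h : pb N f j α = 0) : ∃ s, s ∉ p ∧ s • α = 0 := by
  cases j with
  | zero => exact ⟨1, (Ideal.ne_top_iff_one p).1 hp, by rw [pb_inj_zero f hf α h, smul_zero]⟩
  | succ j =>
    obtain ⟨γ, rfl⟩ := Abelian.Ext.contravariant_sequence_exact₃
      (LinearMap.shortExact_shortComplexKer hf) _ α h (add_comm 1 j)
    obtain ⟨s, hs, h⟩ := hS j (Nat.lt_succ_self j) γ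
    exact ⟨s, hs, by rw [← Abelian.Ext.comp_smul, h, Abelian.Ext.comp_zero]⟩

lemma pf_exact (g : N →ₗ[R] N') (hg : Function.Surjective g) (j : ℕ) (α : EE R M N j)
    (h : pf M g j α = 0) : ∃ β, pf M (LinearMap.ker g).subtype j β = α :=
  Abelian.Ext.covariant_sequence_exact₂ _ (LinearMap.shortExact_shortComplexKer hg) α h

lemma pf_inj (p : Ideal R) (g : N →ₗ[R] N') (hg : Function.Surjective g)
    (hp : p ≠ ⊤) (j : ℕ) (hS : ∀ l, l < j → SZ p (EE R M N' l))
    (α : EE R M (LinearMap.ker g) j)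
    (h : pf M (LinearMap.ker g).subtype j α = 0) : ∃ s, s ∉ p ∧ s • α = 0 := by
  cases j with
  | zero =>
    have : Mono (ModuleCat.ofHom (LinearMap.ker g).subtype) :=
      (ModuleCat.mono_iff_injective _).mpr (LinearMap.ker g).injective_subtype
    have h0 : α = 0 := by
      apply Abelian.Ext.postcomp_mk₀_injective_of_mono (ModuleCat.of R M)
        (ModuleCat.ofHom (LinearMap.ker g).subtype)
      rw [map_zero]
      exact h
    exact ⟨1, (Ideal.ne_top_iff_one p).1 hp, by rw [h0, smul_zero]⟩
  | succ j =>
    obtain ⟨γ, rfl⟩ := Abelian.Ext.covariant_sequence_exact₁ _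
      (LinearMap.shortExact_shortComplexKer hg) α h rfl
    obtain ⟨s, hs, h⟩ := hS j (Nat.lt_succ_self j) γ
    exact ⟨s, hs, by rw [← Abelian.Ext.smul_comp, h, Abelian.Ext.zero_comp]⟩

/-- finitely many elements killed simultaneously -/
lemma exists_common {p : Ideal R} [hp : p.IsPrime] {ι : Type*} (t : Finset ι) (x : ι → M)
    (h : ∀ a ∈ t, ∃ s, s ∉ p ∧ s • x a = 0) : ∃ s, s ∉ p ∧ ∀ a ∈ t, s • x a = 0 := by
  classical
  induction t using Finset.induction_on with
  | empty => exact ⟨1, (Ideal.ne_top_iff_one p).1 hp.ne_top, by simp⟩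
  | insert a t ha ih =>
    obtain ⟨s, hs, h1⟩ := ih (fun b hb => h b (Finset.mem_insert_of_mem hb))
    obtain ⟨s', hs', h2⟩ := h a (Finset.mem_insert_self _ _)
    refine ⟨s * s', hp.mul_notMem hs hs', fun b hb => ?_⟩
    rcases Finset.mem_insert.1 hb with rfl | hb
    · rw [mul_smul, h2, smul_zero]
    · rw [mul_comm, mul_smul, h1 b hb, smul_zero]

lemma SZ_pi {p : Ideal R} [hp : p.IsPrime] (k : ℕ) (j : ℕ) (h : SZ p (EE R M N j)) :
    SZ p (EE R (Fin k → M) N j) := by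
  intro α
  obtain ⟨s, hs, h1⟩ := exists_common (p := p) Finset.univ
    (fun a : Fin k => pb N (LinearMap.single R (fun _ => M) a) j α) (fun a _ => h _)
  refine ⟨s, hs, ?_⟩
  have : (LinearMap.id : (Fin k → M) →ₗ[R] (Fin k → M)) =
      ∑ a, (LinearMap.single R (fun _ => M) a) ∘ₗ LinearMap.proj a := by
    ext a m b
    simp [Pi.single_apply]
  rw [← pb_id j α, this, pb_sum, Finset.smul_sum]
  refine Finset.sum_eq_zero fun a ha => ?_
  rw [pb_comp, ← map_smul, h1 a ha, map_zero]

/-- A module killed by `I` which is finitely generated is a quotient of `(R/I)^k`. -/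
lemma exists_surj (I : Ideal R) [Module.Finite R M] (h : ∀ r ∈ I, ∀ m : M, r • m = 0) :
    ∃ (k : ℕ) (f : (Fin k → R ⧸ I) →ₗ[R] M), Function.Surjective f := by
  obtain ⟨k, v, hv⟩ := Module.Finite.exists_fin (R := R) (M := M)
  let g : Fin k → ((R ⧸ I) →ₗ[R] M) := fun a =>
    Submodule.liftQ I (LinearMap.toSpanSingleton R M (v a)) (fun r hr => by simpa using h r hr _)
  refine ⟨k, ∑ a, g a ∘ₗ LinearMap.proj a, ?_⟩
  rw [← LinearMap.range_eq_top, eq_top_iff, ← hv, Submodule.span_le]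
  rintro _ ⟨a, rfl⟩
  refine ⟨Pi.single a (Submodule.Quotient.mk 1), ?_⟩
  simp only [LinearMap.sum_apply, LinearMap.comp_apply, LinearMap.proj_apply]
  rw [Finset.sum_eq_single a]
  · rw [Pi.single_eq_same]
    simp only [g]
    erw [Submodule.liftQ_apply]
    simp
  · intro b _ hb
    rw [Pi.single_eq_of_ne hb, map_zero]
  · simp

/-- Lemma A, killed by `I`. -/
lemma SZ_killed [IsNoetherianRing R] {p : Ideal R} [hp : p.IsPrime] (I : Ideal R) (i : ℕ)
    (hC : ∀ j < i, SZ p (EE R (R ⧸ I) N j)) (j : ℕ) (hj : j < i) :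
    ∀ (M : Type u) [AddCommGroup M] [Module R M] [Module.Finite R M]
      (_ : ∀ r ∈ I, ∀ m : M, r • m = 0), SZ p (EE R M N j) := by
  induction j using Nat.strong_induction_on with
  | _ j ih =>
    intro M _ _ _ hM α
    obtain ⟨k, f, hf⟩ := exists_surj I hM
    obtain ⟨s, hs, h1⟩ := SZ_pi k j (hC j hj) (pb N f j α)
    rw [← map_smul] at h1
    have := isNoetherian_of_isNoetherianRing_of_finite R (Fin k → R ⧸ I)
    obtain ⟨t, ht, h2⟩ := pb_inj p f hf hp.ne_top j (fun l hl => ih l hl (hl.trans hj) _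
      (fun r hr m => by
        apply Subtype.ext
        funext a
        simp only [Submodule.coe_smul, Pi.smul_apply]
        obtain ⟨y, hy⟩ := Submodule.Quotient.mk_surjective _ (m.1 a)
        rw [← hy, ← Submodule.Quotient.mk_smul]
        exact (Submodule.Quotient.mk_eq_zero I).2 (I.mul_mem_right _ hr))) _ h1
    exact ⟨t * s, hp.mul_notMem ht hs, by rw [mul_smul, h2]⟩

/-- Lemma A. -/
lemma SZ_pow [IsNoetherianRing R] {p : Ideal R} [hp : p.IsPrime] (I : Ideal R) (i : ℕ)
    (hC : ∀ j < i, SZ p (EE R (R ⧸ I) N j)) (j : ℕ) (hj : j < i) (n : ℕ) :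
    ∀ (M : Type u) [AddCommGroup M] [Module R M] [Module.Finite R M]
      (_ : ∀ r ∈ I ^ n, ∀ m : M, r • m = 0), SZ p (EE R M N j) := by
  induction n with
  | zero =>
    intro M _ _ _ hM α
    exact ⟨1, (Ideal.ne_top_iff_one p).1 hp.ne_top,
      smul_EE_left 1 (fun m => hM 1 (by simp) m) j α⟩
  | succ n ih =>
    intro M _ _ _ hM α
    let f := (I • ⊤ : Submodule R M).mkQ
    have hf : Function.Surjective f := Submodule.mkQ_surjective _
    obtain ⟨s, hs, h1⟩ := ih (LinearMap.ker f) (fun r hr m => by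
      apply Subtype.ext
      obtain ⟨m, hm⟩ := m
      simp only [f, Submodule.ker_mkQ] at hm
      simp only [SetLike.mk_smul_mk, ZeroMemClass.coe_zero]
      refine Submodule.smul_induction_on (p := fun m => r • m = 0) hm ?_ ?_
      · intro a ha y _
        rw [← mul_smul]
        exact hM _ (by rw [pow_succ]; exact Ideal.mul_mem_mul hr ha) _
      · intro x y hx hy
        rw [smul_add, hx, hy, add_zero]) (pb N (LinearMap.ker f).subtype j α)
    rw [← map_smul] at h1
    obtain ⟨β, hβ⟩ := pb_exact f hf j _ h1
    obtain ⟨t, ht, h2⟩ := SZ_killed (N := N) I i hC j hj (M ⧸ (I • ⊤ : Submodule R M))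
      (fun r hr m => by
        obtain ⟨y, rfl⟩ := Submodule.Quotient.mk_surjective _ m
        rw [← Submodule.Quotient.mk_smul, Submodule.Quotient.mk_eq_zero]
        exact Submodule.smul_mem_smul hr trivial) β
    refine ⟨t * s, hp.mul_notMem ht hs, ?_⟩
    rw [mul_smul, ← hβ, ← map_smul, h2, map_zero]

/-- The maps `R/I^n → R/I` etc. -/
abbrev qmap {J K : Ideal R} (h : J ≤ K) : (R ⧸ J) →ₗ[R] (R ⧸ K) :=
  Submodule.mapQ J K LinearMap.id h

lemma qmap_surj {J K : Ideal R} (h : J ≤ K) : Function.Surjective (qmap h) := by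
  intro x
  obtain ⟨y, rfl⟩ := Submodule.Quotient.mk_surjective _ x
  exact ⟨Submodule.Quotient.mk y, rfl⟩

lemma qmap_comp {J K L : Ideal R} (h : J ≤ K) (h' : K ≤ L) :
    qmap h' ∘ₗ qmap h = qmap (h.trans h') := by
  ext; rfl

lemma quot_killed (J : Ideal R) : ∀ r ∈ J, ∀ m : R ⧸ J, r • m = 0 := by
  intro r hr m
  obtain ⟨y, rfl⟩ := Submodule.Quotient.mk_surjective _ m
  rw [← Submodule.Quotient.mk_smul]
  exact (Submodule.Quotient.mk_eq_zero J).2 (J.mul_mem_right _ hr)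

/-- Lemma B. -/
lemma lemB [IsNoetherianRing R] {p : Ideal R} [hp : p.IsPrime] (I : Ideal R) (i : ℕ)
    (hC : ∀ j < i, SZ p (EE R (R ⧸ I) N j)) (n : ℕ) [Module.Finite R M]
    (hM : ∀ r ∈ I ^ n, ∀ m : M, r • m = 0) (f : M →ₗ[R] M') (hf : Function.Surjective f)
    (α : EE R M' N i) (h : pb N f i α = 0) : ∃ s, s ∉ p ∧ s • α = 0 := by
  have := isNoetherian_of_isNoetherianRing_of_finite R M
  exact pb_inj p f hf hp.ne_top i (fun l hl => SZ_pow I i hC l hl n _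
    (fun r hr m => Subtype.ext (hM r hr m.1))) α h

/-- Lemma C. -/
lemma lemC [IsNoetherianRing R] {p : Ideal R} [hp : p.IsPrime] (I : Ideal R) (i : ℕ)
    (hC : ∀ j < i, SZ p (EE R (R ⧸ I) N j)) (n : ℕ) (hn : I ^ n ≤ I)
    (α : EE R (R ⧸ I ^ n) N i) (hα : ∀ x ∈ I, x • α = 0) :
    ∃ s, s ∉ p ∧ ∃ β, pb N (qmap hn) i β = s • α := by
  have hq := qmap_surj hn
  obtain ⟨k, v, hv⟩ := Submodule.fg_iff_exists_fin_generating_family.1 (IsNoetherian.noetherian I)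
  have hvI : ∀ a, v a ∈ I := fun a => by rw [← hv]; exact Submodule.subset_span ⟨a, rfl⟩
  let g0 : (Fin k → R ⧸ I ^ n) →ₗ[R] (R ⧸ I ^ n) := ∑ a, v a • LinearMap.proj a
  have hg0 : ∀ x, g0 x ∈ LinearMap.ker (qmap hn) := by
    intro x
    simp only [g0, LinearMap.sum_apply, LinearMap.smul_apply, LinearMap.proj_apply]
    refine Submodule.sum_mem _ fun a _ => ?_
    rw [LinearMap.mem_ker, map_smul]
    exact quot_killed I _ (hvI a) _
  let g : (Fin k → R ⧸ I ^ n) →ₗ[R] LinearMap.ker (qmap hn) := g0.codRestrict _ hg0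
  have hg : Function.Surjective g := by
    rintro ⟨y, hy⟩
    obtain ⟨y, rfl⟩ := Submodule.Quotient.mk_surjective _ y
    have hyI : y ∈ I := (Submodule.Quotient.mk_eq_zero I).1 hy
    rw [← hv, Submodule.mem_span_range_iff_exists_fun] at hyI
    obtain ⟨c, rfl⟩ := hyI
    refine ⟨fun a => Submodule.Quotient.mk (c a), Subtype.ext ?_⟩
    change g0 _ = (I ^ n).mkQ _
    rw [map_sum]
    simp only [g0, LinearMap.sum_apply, LinearMap.smul_apply, LinearMap.proj_apply]
    refine Finset.sum_congr rfl fun a _ => ?_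
    rw [← Submodule.Quotient.mk_smul, smul_eq_mul, smul_eq_mul, mul_comm]
    rfl
  obtain ⟨s, hs, h1⟩ := lemB I i hC n (M := Fin k → R ⧸ I ^ n)
    (fun r hr m => funext fun a => quot_killed _ r hr _) g hg
    (pb N (LinearMap.ker (qmap hn)).subtype i α) (by
      rw [← pb_comp]
      have : (LinearMap.ker (qmap hn)).subtype ∘ₗ g = g0 := by ext; rfl
      rw [this, pb_sum]
      refine Finset.sum_eq_zero fun a _ => ?_
      rw [pb_smul, ← map_smul, hα _ (hvI a), map_zero])
  rw [← map_smul] at h1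
  exact ⟨s, hs, pb_exact _ hq i _ h1⟩

/-- A finitely generated module with `M_p = 0` is killed by some `s ∉ p`. -/
lemma exists_kill {p : Ideal R} [hp : p.IsPrime] [Module.Finite R M] (h : SZ p M) :
    ∃ s, s ∉ p ∧ ∀ m : M, s • m = 0 := by
  have h1 : (⟨p, hp⟩ : PrimeSpectrum R) ∉ Module.support R M := Module.notMem_support_iff'.2 h
  rw [Module.mem_support_iff_of_finite, SetLike.not_le_iff_exists] at h1
  obtain ⟨s, hs, hsp⟩ := h1
  exact ⟨s, hsp, fun m => Module.mem_annihilator.1 hs m⟩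

/-- Covariant step. -/
lemma cov_step [IsNoetherianRing R] {p : Ideal R} [hp : p.IsPrime] [Module.Finite R N] (x : R)
    (hx : ∀ m : M, x • m = 0) (f : N →ₗ[R] N') (hf : Function.Surjective f)
    (hker : LinearMap.ker f = LinearMap.range (x • (LinearMap.id : N →ₗ[R] N)))
    (hK : SZ p (LinearMap.ker (x • (LinearMap.id : N →ₗ[R] N)))) (n : ℕ)
    (h : ∀ j < n, SZ p (EE R M N' j)) : ∀ j < n + 1, SZ p (EE R M N j) := by
  intro j hj α
  have := isNoetherian_of_isNoetherianRing_of_finite R N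
  let g : N →ₗ[R] LinearMap.ker f :=
    (x • (LinearMap.id : N →ₗ[R] N)).codRestrict _ (fun y => by rw [hker]; exact ⟨y, rfl⟩)
  have hg : Function.Surjective g := by
    rintro ⟨y, hy⟩
    have hy' := hy
    rw [hker] at hy'
    obtain ⟨z, rfl⟩ := hy'
    exact ⟨z, rfl⟩
  have hgk : LinearMap.ker g = LinearMap.ker (x • (LinearMap.id : N →ₗ[R] N)) :=
    LinearMap.ker_codRestrict _ _ _
  have h0 : pf M (LinearMap.ker f).subtype j (pf M g j α) = 0 := by
    rw [← pf_comp]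
    have : (LinearMap.ker f).subtype ∘ₗ g = x • LinearMap.id := by ext; rfl
    rw [this, pf_smul, pf_id, smul_EE_left x hx]
  obtain ⟨s, hs, h1⟩ := pf_inj p f hf hp.ne_top j (fun l hl => h l (by omega)) _ h0
  rw [← map_smul] at h1
  obtain ⟨δ, hδ⟩ := pf_exact g hg j _ h1
  rw [← hgk] at hK
  obtain ⟨t, ht, h2⟩ := exists_kill hK
  refine ⟨t * s, hp.mul_notMem ht hs, ?_⟩
  rw [mul_smul, ← hδ, ← map_smul, smul_EE_right t h2, map_zero]

/-- `ker x` vanishes at `p` if `x` avoids the big associated primes. -/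
lemma SZ_ker [IsNoetherianRing R] {p : Ideal R} [hp : p.IsPrime] (x : R)
    (hd : (2 : WithBot ℕ∞) ≤ ringKrullDim (R ⧸ p))
    (hx : ∀ q ∈ associatedPrimes R N, (2 : WithBot ℕ∞) ≤ ringKrullDim (R ⧸ q) → x ∉ q) :
    SZ p (LinearMap.ker (x • (LinearMap.id : N →ₗ[R] N))) := by
  intro m
  by_contra hcon
  push Not at hcon
  obtain ⟨m, hm⟩ := m
  have hm' : x • m = 0 := hm
  -- the cyclic submodule generated by m
  let C : Submodule R N := Submodule.span R {m}
  let mC : C := ⟨m, Submodule.mem_span_singleton_self m⟩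
  have hsup : (⟨p, hp⟩ : PrimeSpectrum R) ∈ Module.support R C := by
    rw [Module.mem_support_iff']
    refine ⟨mC, fun r hr h0 => hcon r hr (Subtype.ext ?_)⟩
    exact (congrArg (fun c : C => (c : N)) h0 : r • m = 0)
  have hann : Module.annihilator R C ≤ p := Module.mem_support_iff_of_finite.1 hsup
  obtain ⟨q, hq, hqp⟩ := Ideal.exists_minimalPrimes_le hann
  have hqa : q ∈ associatedPrimes R C :=
    Module.associatedPrimes.minimalPrimes_annihilator_subset_associatedPrimes R C hq
  have hqN : q ∈ associatedPrimes R N :=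
    associatedPrimes.subset_of_injective (f := C.subtype) C.injective_subtype hqa
  have hxq : x ∈ q := hq.1.2 (Module.mem_annihilator.2 (fun c => by
    obtain ⟨c, hc⟩ := c
    obtain ⟨r, rfl⟩ := Submodule.mem_span_singleton.1 hc
    apply Subtype.ext
    change x • r • m = 0
    rw [smul_comm, hm', smul_zero]))
  refine hx q hqN (hd.trans ?_) hxq
  exact ringKrullDim_le_of_surjective (Ideal.Quotient.factor hqp)
    (Ideal.Quotient.factor_surjective hqp)

lemma SZ_of_equiv {p : Ideal R} (e : N ≃ₗ[R] N') (j : ℕ) (h : SZ p (EE R M N' j)) :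
    SZ p (EE R M N j) := by
  intro α
  obtain ⟨s, hs, h1⟩ := h (pf M e.toLinearMap j α)
  refine ⟨s, hs, ?_⟩
  have h2 : pf M e.symm.toLinearMap j (pf M e.toLinearMap j α) = α := by
    rw [← pf_comp]
    have : e.symm.toLinearMap ∘ₗ e.toLinearMap = LinearMap.id := by ext; simp
    rw [this, pf_id]
  rw [← h2, ← map_smul, h1, map_zero]

/-- Vanishing of Ext at big primes below the length of a generalized regular sequence. -/
lemma SZ_genReg [IsNoetherianRing R] {p : Ideal R} [hp : p.IsPrime] [Module.Finite R N]
    (I : Ideal R) (hd : (2 : WithBot ℕ∞) ≤ ringKrullDim (R ⧸ p)) (xs : List R)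
    (hxs : IsGenRegSeq I (ModuleCat.of R N) xs) :
    ∀ j < xs.length, SZ p (EE R (R ⧸ I) N j) := by
  obtain ⟨hI, hreg⟩ := hxs
  let J : ℕ → Ideal R := fun k => Ideal.span {x | x ∈ xs.take k}
  have key : ∀ n k, n + k = xs.length →
      ∀ j < n, SZ p (EE R (R ⧸ I) (N ⧸ (J k • (⊤ : Submodule R N))) j) := by
    intro n
    induction n with
    | zero => intro k _ j hj; omega
    | succ n ih =>
      intro k hk
      have hkl : k < xs.length := by omega
      let x := xs.get ⟨k, hkl⟩
      have hJ : J (k + 1) = J k ⊔ Ideal.span {x} := by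
        simp only [J]
        rw [← Ideal.span_union]
        congr 1
        ext y
        rw [List.take_succ_eq_append_getElem hkl]
        rw [Set.mem_ofPred_eq, List.mem_append, List.mem_singleton]
        rfl
      have hle : J k • (⊤ : Submodule R N) ≤ J (k + 1) • ⊤ :=
        Submodule.smul_mono_left (by rw [hJ]; exact le_sup_left)
      let f := Submodule.mapQ (J k • (⊤ : Submodule R N)) (J (k + 1) • ⊤) LinearMap.id hle
      refine cov_step x (fun m => quot_killed I x (hI _ (List.get_mem xs ⟨k, hkl⟩)) m) f ?_ ?_ ?_ n
        (ih (k + 1) (by omega))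
      · intro y
        obtain ⟨y, rfl⟩ := Submodule.Quotient.mk_surjective _ y
        exact ⟨Submodule.Quotient.mk y, rfl⟩
      · apply le_antisymm
        · intro y hy
          obtain ⟨y, rfl⟩ := Submodule.Quotient.mk_surjective _ y
          have hy1 : y ∈ J (k + 1) • (⊤ : Submodule R N) :=
            (Submodule.Quotient.mk_eq_zero _).1 hy
          rw [hJ, Submodule.sup_smul, Submodule.mem_sup] at hy1
          obtain ⟨a, ha, b, hb, rfl⟩ := hy1
          rw [Submodule.ideal_span_singleton_smul] at hb
          obtain ⟨c, _, rfl⟩ := hb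
          refine ⟨Submodule.Quotient.mk c, ?_⟩
          rw [Submodule.Quotient.mk_add, (Submodule.Quotient.mk_eq_zero _).2 ha, zero_add]
          rfl
        · rintro _ ⟨y, rfl⟩
          obtain ⟨y, rfl⟩ := Submodule.Quotient.mk_surjective _ y
          refine (Submodule.Quotient.mk_eq_zero (J (k + 1) • (⊤ : Submodule R N))
            (x := x • y)).2 (Submodule.smul_mem_smul ?_ trivial)
          rw [hJ]
          exact le_sup_right (a := J k) (Ideal.mem_span_singleton_self x)
      · exact SZ_ker x hd (hreg ⟨k, hkl⟩)
  intro j hj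
  have h0 := key xs.length 0 rfl j hj
  have hb : J 0 • (⊤ : Submodule R N) = ⊥ := by simp [J]
  exact SZ_of_equiv (Submodule.quotEquivOfEqBot _ hb).symm j h0

section Bridge

lemma iso_sq {C : Type*} [Category* C] {A B D E : C} (a : A ≅ B) (b : D ≅ E) (f : A ⟶ D)
    (g : B ⟶ E) (h : f ≫ b.hom = a.hom ≫ g) : a.inv ≫ f = g ≫ b.inv := by
  rw [Iso.inv_comp_eq, ← Category.assoc, ← h, Category.assoc, Iso.hom_inv_id, Category.comp_id]

lemma homologyUnop_nat {V : Type*} [Category* V] [Abelian V] {ι : Type*} {c : ComplexShape ι}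
    {K L : HomologicalComplex Vᵒᵖ c} (φ : K ⟶ L) (i : ι) :
    (HomologicalComplex.homologyMap φ i).unop ≫ (K.homologyUnop i).inv =
      (L.homologyUnop i).inv ≫
        HomologicalComplex.homologyMap ((HomologicalComplex.unopFunctor V c).map φ.op) i := by
  have h := HomologicalComplex.homologyOp_hom_naturality
    ((HomologicalComplex.unopFunctor V c).map φ.op) i
  exact congrArg Quiver.Hom.unop (iso_sq _ _ _ _ h)

variable {R : Type u} [CommRing R] {X X' Y : ModuleCat.{u} R}

lemma extMk_congr (P : ProjectiveResolution X) (n : ℕ) (f g : P.complex.X n ⟶ Y)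
    (hf : P.complex.d (n + 1) n ≫ f = 0) (hg : P.complex.d (n + 1) n ≫ g = 0) (h : f = g) :
    P.extMk f (n + 1) rfl hf = P.extMk g (n + 1) rfl hg := by
  subst h; rfl

lemma extMk_zero_iff (P : ProjectiveResolution X) (n : ℕ) (f : P.complex.X n ⟶ Y)
    (hf : P.complex.d (n + 1) n ≫ f = 0) :
    P.extMk f (n + 1) rfl hf = 0 ↔
      ∃ g : P.complex.X ((ComplexShape.up ℕ).prev n) ⟶ Y,
        P.complex.d n ((ComplexShape.up ℕ).prev n) ≫ g = f := by
  cases n with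
  | succ n =>
    rw [P.extMk_eq_zero_iff f (n + 2) rfl hf n rfl]
    have : (ComplexShape.up ℕ).prev (n + 1) = n := CochainComplex.prev_nat_succ n
    rw [this]
  | zero =>
    have h0 : P.complex.d 0 ((ComplexShape.up ℕ).prev 0) = 0 := by
      apply P.complex.shape
      simp
    rw [h0]
    simp only [zero_comp, exists_const]
    constructor
    · intro h
      simp only [← P.extEquivCohomologyClass.apply_eq_iff_eq,
        ProjectiveResolution.extEquivCohomologyClass_extMk,
        ProjectiveResolution.extEquivCohomologyClass_zero,
        CochainComplex.HomComplex.CohomologyClass.mk_eq_zero_iff] at h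
      rw [CochainComplex.HomComplex.Cocycle.toSingleMk_mem_coboundaries_iff _ _ _ _ _ 1
        (by simp)] at h
      obtain ⟨g, hg⟩ := h
      have hz : IsZero (P.cochainComplex.X 1) :=
        CochainComplex.isZero_of_isStrictlyLE _ 0 _ (by simp)
      rw [hz.eq_of_src g 0, comp_zero] at hg
      rw [← cancel_epi (P.cochainComplexXIso (-(0:ℕ)) 0 rfl).hom, comp_zero]
      exact hg
    · intro h
      subst h
      exact P.extMk_zero 1 rfl

/-- The class map on cycles. -/
def cyc (P : ProjectiveResolution X) (Y : ModuleCat.{u} R) (n : ℕ) :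
    LinearMap.ker ((P.complex.linearYonedaObj R Y).d n (n + 1)).hom →ₗ[R] Abelian.Ext X Y n where
  toFun z := P.extMk (n := n) (Y := Y) z.1 (n + 1) rfl z.2
  map_add' a b := (P.add_extMk _ _ _ _ _ _).symm
  map_smul' r a := by
    rw [RingHom.id_apply, Abelian.Ext.smul_eq_comp_mk₀]
    refine Eq.trans ?_ (P.extMk_comp_mk₀ (n := n) (Y := Y) a.1 (n + 1) rfl a.2 (r • 𝟙 Y)).symm
    congr 1

lemma cyc_surj (P : ProjectiveResolution X) (Y : ModuleCat.{u} R) (n : ℕ) :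
    Function.Surjective (cyc P Y n) := by
  intro α
  obtain ⟨f, hf, rfl⟩ := P.extMk_surjective α (n + 1) rfl
  exact ⟨⟨f, hf⟩, rfl⟩

lemma isoExt_nat (P : ProjectiveResolution X) (P' : ProjectiveResolution X') (g : X' ⟶ X) (n : ℕ)
   (φ : ProjectiveResolution.Hom P' P g)  :
   ((Ext R (ModuleCat.{u} R) n).map g.op).app Y ≫ (P'.isoExt n Y).hom =
    (P.isoExt n Y).hom ≫ HomologicalComplex.homologyMap ((HomologicalComplex.unopFunctor _ _).map ((((linearYoneda R (ModuleCat.{u} R)).obj Y).rightOp.mapHomologicalComplex _).map φ.hom).op) n := by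
  have h := ProjectiveResolution.isoLeftDerivedObj_inv_naturality g P' P φ.hom
    (by rw [φ.hom_f_zero_comp_π_f_zero]; rfl) ((linearYoneda R (ModuleCat.{u} R)).obj Y).rightOp n
  have h' := congrArg Quiver.Hom.unop h
  rw [unop_comp, unop_comp] at h'
  have h2 := homologyUnop_nat ((((linearYoneda R (ModuleCat.{u} R)).obj Y).rightOp.mapHomologicalComplex _).map φ.hom) n
  refine (Category.assoc _ _ _).symm.trans ((congrArg (· ≫ _) h').trans ?_)
  refine (Category.assoc _ _ _).trans (Eq.trans ?_ (Category.assoc _ _ _).symm)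
  exact congrArg (_ ≫ ·) h2

/-- The complex computing Ext. -/
abbrev KK (P : ProjectiveResolution X) (Y : ModuleCat.{u} R) := P.complex.linearYonedaObj R Y

/-- cycles into the kernel. -/
def icyc (P : ProjectiveResolution X) (Y : ModuleCat.{u} R) (n : ℕ) :
    (KK P Y).cycles n →ₗ[R] LinearMap.ker ((P.complex.linearYonedaObj R Y).d n (n + 1)).hom :=
  LinearMap.codRestrict _ ((KK P Y).iCycles n).hom (fun z => by
    have := (KK P Y).iCycles_d n (n + 1)
    exact congrArg (fun f => f.hom z) this)

/-- The class map on cycles. -/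
def cl (P : ProjectiveResolution X) (Y : ModuleCat.{u} R) (n : ℕ) :
    (KK P Y).cycles n →ₗ[R] Abelian.Ext X Y n := (cyc P Y n) ∘ₗ icyc P Y n

lemma cl_surj (P : ProjectiveResolution X) (Y : ModuleCat.{u} R) (n : ℕ) :
    Function.Surjective (cl P Y n) := by
  refine (cyc_surj P Y n).comp ?_
  intro z
  have h : ((KK P Y).d n (n + 1)).hom z.1 = 0 := z.2
  refine ⟨(KK P Y).cyclesMk z.1 (n + 1) (CochainComplex.next ℕ n) h, Subtype.ext ?_⟩
  exact (KK P Y).i_cyclesMk z.1 (n + 1) (CochainComplex.next ℕ n) h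

lemma piC_surj (P : ProjectiveResolution X) (Y : ModuleCat.{u} R) (n : ℕ) :
    Function.Surjective ((KK P Y).homologyπ n).hom :=
  (ModuleCat.epi_iff_surjective _).1 inferInstance

lemma piC_zero (P : ProjectiveResolution X) (Y : ModuleCat.{u} R) (n : ℕ) (z : (KK P Y).cycles n) :
    ((KK P Y).homologyπ n).hom z = 0 ↔
      ∃ w, ((KK P Y).toCycles ((ComplexShape.up ℕ).prev n) n).hom w = z := by
  have hex := ShortComplex.exact_of_g_is_cokernel
    (ShortComplex.mk _ _ ((KK P Y).toCycles_comp_homologyπ ((ComplexShape.up ℕ).prev n) n))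
    ((KK P Y).homologyIsCokernel _ n rfl)
  rw [ShortComplex.moduleCat_exact_iff] at hex
  constructor
  · exact hex z
  · rintro ⟨w, rfl⟩
    exact congrArg (fun f => f.hom w)
      ((KK P Y).toCycles_comp_homologyπ ((ComplexShape.up ℕ).prev n) n)

lemma ker_eq (P : ProjectiveResolution X) (Y : ModuleCat.{u} R) (n : ℕ) :
    LinearMap.ker ((KK P Y).homologyπ n).hom = LinearMap.ker (cl P Y n) := by
  ext z
  rw [LinearMap.mem_ker, LinearMap.mem_ker, piC_zero]
  refine Iff.trans ?_ (extMk_zero_iff P n (Y := Y) (icyc P Y n z).1 (icyc P Y n z).2).symm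
  have hinj : Function.Injective ((KK P Y).iCycles n).hom :=
    (ModuleCat.mono_iff_injective _).1 inferInstance
  refine exists_congr fun w => ?_
  rw [← hinj.eq_iff]
  have := congrArg (fun f => f.hom w) ((KK P Y).toCycles_i ((ComplexShape.up ℕ).prev n) n)
  exact ⟨fun h => this.symm.trans h, fun h => this.trans h⟩

/-- Homology is Ext. -/
def hEquiv (P : ProjectiveResolution X) (Y : ModuleCat.{u} R) (n : ℕ) :
    (KK P Y).homology n ≃ₗ[R] Abelian.Ext X Y n :=
  (((KK P Y).homologyπ n).hom.quotKerEquivOfSurjective (piC_surj P Y n)).symm.trans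
    ((Submodule.quotEquivOfEq _ _ (ker_eq P Y n)).trans
      ((cl P Y n).quotKerEquivOfSurjective (cl_surj P Y n)))

lemma hEquiv_pi (P : ProjectiveResolution X) (Y : ModuleCat.{u} R) (n : ℕ)
    (z : (KK P Y).cycles n) : hEquiv P Y n (((KK P Y).homologyπ n).hom z) = cl P Y n z := by
  unfold hEquiv
  rw [LinearEquiv.trans_apply]
  have : (((KK P Y).homologyπ n).hom.quotKerEquivOfSurjective (piC_surj P Y n)).symm
    (((KK P Y).homologyπ n).hom z) = Submodule.Quotient.mk z := by
    rw [LinearEquiv.symm_apply_eq]; rfl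
  rw [this]; rfl

/-- The bridge. -/
def bridge (X Y : ModuleCat.{u} R) (n : ℕ) :
    ((Ext R (ModuleCat.{u} R) n).obj (op X)).obj Y ≃ₗ[R] Abelian.Ext X Y n :=
  ((projectiveResolution X).isoExt n Y).toLinearEquiv.trans (hEquiv _ Y n)

lemma hEquiv_nat (P : ProjectiveResolution X) (P' : ProjectiveResolution X') (g : X' ⟶ X) (n : ℕ)
    (φ : ProjectiveResolution.Hom P' P g) (h : (KK P Y).homology n) :
    hEquiv P' Y n ((HomologicalComplex.homologyMap ((HomologicalComplex.unopFunctor _ _).map ((((linearYoneda R (ModuleCat.{u} R)).obj Y).rightOp.mapHomologicalComplex _).map φ.hom).op) n).hom h) =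
      (Abelian.Ext.mk₀ g).comp (hEquiv P Y n h) (zero_add n) := by
  obtain ⟨z, rfl⟩ := piC_surj P Y n h
  rw [hEquiv_pi]
  let ψ : KK P Y ⟶ KK P' Y := ((HomologicalComplex.unopFunctor _ _).map ((((linearYoneda R (ModuleCat.{u} R)).obj Y).rightOp.mapHomologicalComplex _).map φ.hom).op)
  have h1 : (HomologicalComplex.homologyMap ψ n).hom (((KK P Y).homologyπ n).hom z) =
     ((KK P' Y).homologyπ n).hom ((HomologicalComplex.cyclesMap ψ n).hom z) :=
    congrArg (fun f => f.hom z) (HomologicalComplex.homologyπ_naturality ψ n)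
  refine (congrArg (hEquiv P' Y n) h1).trans ?_
  rw [hEquiv_pi]
  have h2 : ((KK P' Y).iCycles n).hom ((HomologicalComplex.cyclesMap ψ n).hom z) =
    (ψ.f n).hom (((KK P Y).iCycles n).hom z) :=
    congrArg (fun f => f.hom z) (HomologicalComplex.cyclesMap_i ψ n)
  refine Eq.trans ?_ (ProjectiveResolution.mk₀_comp_extMk (Y := Y) (icyc P Y n z).1 (n + 1) rfl
    (icyc P Y n z).2 φ).symm
  exact extMk_congr P' n _ _ (icyc P' Y n _).2 _ h2

lemma bridge_nat (g : X' ⟶ X) (Y : ModuleCat.{u} R) (n : ℕ)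
    (x : ((Ext R (ModuleCat.{u} R) n).obj (op X)).obj Y) :
    bridge X' Y n ((((Ext R (ModuleCat.{u} R) n).map g.op).app Y).hom x) =
      (Abelian.Ext.mk₀ g).comp (bridge X Y n x) (zero_add n) := by
  have hl := ProjectiveResolution.lift_commutes_zero g (projectiveResolution X') (projectiveResolution X)
  let φ : ProjectiveResolution.Hom (projectiveResolution X') (projectiveResolution X) g :=
    ⟨ProjectiveResolution.lift g _ _, hl⟩
  have h := congrArg (fun f => f.hom x)
    (isoExt_nat (Y := Y) (projectiveResolution X) (projectiveResolution X') g n φ)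
  refine Eq.trans ?_ (hEquiv_nat (Y := Y) (projectiveResolution X) (projectiveResolution X') g n φ
    (((projectiveResolution X).isoExt n Y).hom.hom x))
  exact congrArg (hEquiv (projectiveResolution X') Y n) h
end Bridge

section LC

variable {R : Type u} [CommRing R] (I : Ideal R) (N : Type u) [AddCommGroup N] [Module R N] (j : ℕ)

/-- The evaluated diagram. -/
abbrev dg : (ℕᵒᵖ)ᵒᵖ ⥤ ModuleCat.{u} R :=
  localCohomology.diagram (localCohomology.idealPowersDiagram I) j ⋙
    (evaluation _ _).obj (ModuleCat.of R N)

/-- The evaluated cocone. -/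
def cc : Cocone (dg I N j) :=
  ((evaluation _ _).obj (ModuleCat.of R N)).mapCocone
    (colimit.cocone (localCohomology.diagram (localCohomology.idealPowersDiagram I) j))

/-- It is a colimit. -/
def ccl : IsColimit (cc I N j) :=
  isColimitOfPreserves ((evaluation _ _).obj (ModuleCat.of R N)) (colimit.isColimit _)

/-- Local cohomology. -/
abbrev LC : ModuleCat.{u} R := (localCohomology I j).obj (ModuleCat.of R N)

/-- The bridge for the diagram. -/
def br (n : ℕ) : (dg I N j).obj (op (op n)) ≃ₗ[R] EE R (R ⧸ I ^ n) N j :=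
  bridge (ModuleCat.of R (R ⧸ I ^ n)) (ModuleCat.of R N) j

/-- The structure map. -/
def phi (n : ℕ) : EE R (R ⧸ I ^ n) N j →ₗ[R] LC I N j :=
  ((cc I N j).ι.app (op (op n))).hom ∘ₗ (br I N j n).symm.toLinearMap

lemma phi_br (n : ℕ) (x : (dg I N j).obj (op (op n))) :
    phi I N j n (br I N j n x) = ((cc I N j).ι.app (op (op n))).hom x :=
  congrArg ((cc I N j).ι.app (op (op n))).hom (LinearEquiv.symm_apply_apply (br I N j n) x)

lemma bridge_pb {J K : Ideal R} (h : J ≤ K)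
    (x : ((Ext R (ModuleCat.{u} R) j).obj (op (ModuleCat.of R (R ⧸ K)))).obj (ModuleCat.of R N)) :
    bridge (ModuleCat.of R (R ⧸ J)) (ModuleCat.of R N) j
      ((((Ext R (ModuleCat.{u} R) j).map (ModuleCat.ofHom (qmap h)).op).app (ModuleCat.of R N)).hom x) =
    pb N (qmap h) j (bridge (ModuleCat.of R (R ⧸ K)) (ModuleCat.of R N) j x) := by
  rw [bridge_nat, pb_apply]

lemma dg_map_eq {n m : ℕ} (h : n ≤ m) : (dg I N j).map (homOfLE h).op.op =
    ((Ext R (ModuleCat.{u} R) j).map (ModuleCat.ofHom (qmap (Ideal.pow_le_pow_right (I := I) h))).op).app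
      (ModuleCat.of R N) := rfl

lemma dg_map {n m : ℕ} (h : n ≤ m) (x : (dg I N j).obj (op (op n))) :
    br I N j m (((dg I N j).map (homOfLE h).op.op).hom x) =
      pb N (qmap (Ideal.pow_le_pow_right h)) j (br I N j n x) := by
  exact bridge_pb N j (Ideal.pow_le_pow_right (I := I) h) x

instance : PreservesColimit (dg I N j) (forget (ModuleCat.{u} R)) := by
  have : PreservesFilteredColimitsOfSize.{0, 0} (forget (ModuleCat.{u} R)) :=
    preservesFilteredColimitsOfSize_shrink.{0, u, 0, u} _
  infer_instance

lemma phi_compat {n m : ℕ} (h : n ≤ m) (x : EE R (R ⧸ I ^ n) N j) :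
    phi I N j m (pb N (qmap (Ideal.pow_le_pow_right h)) j x) = phi I N j n x := by
  obtain ⟨y, rfl⟩ := (br I N j n).surjective x
  rw [← dg_map I N j h y, phi_br, phi_br]
  exact congrArg (fun f => f.hom y) ((cc I N j).w (homOfLE h).op.op)

lemma phi_surj (h : LC I N j) : ∃ n x, phi I N j n x = h := by
  obtain ⟨k, x, hx⟩ := Concrete.isColimit_exists_rep (dg I N j) (ccl I N j) h
  exact ⟨k.unop.unop, br I N j _ x, (phi_br I N j _ x).trans hx⟩

lemma phi_zero (n : ℕ) (x : EE R (R ⧸ I ^ n) N j) (h : phi I N j n x = 0) :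
    ∃ m, ∃ hm : n ≤ m, pb N (qmap (Ideal.pow_le_pow_right hm)) j x = 0 := by
  obtain ⟨y, rfl⟩ := (br I N j n).surjective x
  rw [phi_br] at h
  have h1 : ((cc I N j).ι.app (op (op n))).hom y = ((cc I N j).ι.app (op (op n))).hom 0 := 
    h.trans (map_zero ((cc I N j).ι.app (op (op n))).hom).symm
  obtain ⟨k, f, g, hfg⟩ := Concrete.isColimit_exists_of_rep_eq (dg I N j) (ccl I N j) _ _ h1
  have hm : n ≤ k.unop.unop := leOfHom f.unop.unop
  refine ⟨k.unop.unop, hm, ?_⟩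
  rw [← dg_map I N j hm y]
  have h3 : ((dg I N j).map (homOfLE hm).op.op).hom y = 0 := by
    have : (homOfLE hm).op.op = f := Subsingleton.elim _ _
    rw [this]
    exact hfg.trans (map_zero _)
  rw [h3]
  exact map_zero (br I N j _)

end LC

section Final

set_option linter.unusedSectionVars false

variable {R : Type u} [CommRing R] [IsNoetherianRing R] (I : Ideal R) (N : Type u)
  [AddCommGroup N] [Module R N] (j : ℕ)

lemma ass_iff {M : Type u} [AddCommGroup M] [Module R M] (p : Ideal R) :
    p ∈ associatedPrimes R M ↔ p.IsPrime ∧ ∃ x : M, ∀ r, r ∈ p ↔ r • x = 0 := by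
  rw [AssociatedPrimes.mem_iff, isAssociatedPrime_iff]
  refine and_congr_right fun _ => exists_congr fun x => ?_
  rw [Ideal.ext_iff]
  simp only [Submodule.mem_colon_singleton, Submodule.mem_bot]

/-- The canonical map from Ext to local cohomology. -/
def psi : EE R (R ⧸ I) N j →ₗ[R] LC I N j :=
  phi I N j 1 ∘ₗ pb N (qmap (le_of_eq (pow_one I))) j

lemma psi_eq (m : ℕ) (hm : 1 ≤ m) (h : I ^ m ≤ I) (x : EE R (R ⧸ I) N j) :
    phi I N j m (pb N (qmap h) j x) = psi I N j x := by
  unfold psi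
  rw [LinearMap.comp_apply, ← phi_compat I N j hm, ← pb_comp, qmap_comp]

variable {p : Ideal R} [hp : p.IsPrime]

lemma psi_zero (hC : ∀ l < j, SZ p (EE R (R ⧸ I) N l)) (x : EE R (R ⧸ I) N j)
    (h : psi I N j x = 0) : ∃ s, s ∉ p ∧ s • x = 0 := by
  obtain ⟨m, hm, h0⟩ := phi_zero I N j 1 _ h
  rw [← pb_comp, qmap_comp] at h0
  exact lemB I j hC m (quot_killed _) _ (qmap_surj _) x h0

lemma C_of_LC (i : ℕ) (hS : ∀ j < i, SZ p (LC I N j)) : ∀ j < i, SZ p (EE R (R ⧸ I) N j) := by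
  intro j
  induction j using Nat.strong_induction_on with
  | _ j ih =>
    intro hj α
    obtain ⟨s, hs, h⟩ := hS j hj (psi I N j α)
    rw [← map_smul] at h
    obtain ⟨t, ht, h'⟩ := psi_zero I N j (fun l hl => ih l hl (hl.trans hj)) _ h
    exact ⟨t * s, hp.mul_notMem ht hs, by rw [mul_smul, h']⟩

lemma LC_of_C (i : ℕ) (hC : ∀ l < i, SZ p (EE R (R ⧸ I) N l)) (j : ℕ) (hj : j < i) :
    SZ p (LC I N j) := by
  intro h
  obtain ⟨n, x, rfl⟩ := phi_surj I N j h
  obtain ⟨s, hs, h⟩ := SZ_pow I i hC j hj n (R ⧸ I ^ n) (quot_killed _) x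
  exact ⟨s, hs, by rw [← map_smul, h, map_zero]⟩

lemma kill_gens (n : ℕ) (α : EE R (R ⧸ I ^ n) N j) (t : Finset R)
    (h : ∀ r ∈ t, r • phi I N j n α = 0) :
    ∃ m, ∃ hm : n ≤ m, 1 ≤ m ∧ ∀ r ∈ t, r • pb N (qmap (Ideal.pow_le_pow_right hm)) j α = 0 := by
  classical
  induction t using Finset.induction_on with
  | empty => exact ⟨max n 1, le_max_left _ _, le_max_right _ _, by simp⟩
  | insert a t ha ih =>
    obtain ⟨m, hm, h1, h2⟩ := ih (fun r hr => h r (Finset.mem_insert_of_mem hr))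
    have h3 := h a (Finset.mem_insert_self _ _)
    rw [← map_smul] at h3
    obtain ⟨k, hk, h4⟩ := phi_zero I N j n _ h3
    rw [map_smul] at h4
    refine ⟨max m k, hm.trans (le_max_left _ _), h1.trans (le_max_left _ _), ?_⟩
    intro r hr
    rcases Finset.mem_insert.1 hr with rfl | hr
    · rw [← qmap_comp (Ideal.pow_le_pow_right (le_max_right m k)) (Ideal.pow_le_pow_right hk),
        pb_comp, ← map_smul, h4, map_zero]
    · rw [← qmap_comp (Ideal.pow_le_pow_right (le_max_left m k)) (Ideal.pow_le_pow_right hm),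
        pb_comp, ← map_smul, h2 r hr, map_zero]

lemma span_kill {M : Type u} [AddCommGroup M] [Module R M] (t : Finset R) (J : Ideal R)
    (hJ : Ideal.span (t : Set R) = J) (x : M) (h : ∀ r ∈ t, r • x = 0) : ∀ r ∈ J, r • x = 0 := by
  subst hJ
  intro r hr
  have : Ideal.span (t : Set R) ≤ LinearMap.ker (LinearMap.toSpanSingleton R M x) :=
    Ideal.span_le.2 fun a ha => by simpa using h a ha
  simpa using this hr

lemma ass_of_LC (i : ℕ) (hS : ∀ j < i, SZ p (LC I N j)) :
    p ∈ associatedPrimes R (LC I N i) ↔ p ∈ associatedPrimes R (EE R (R ⧸ I) N i) := by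
  have hC := C_of_LC I N i hS
  obtain ⟨tp, htp⟩ := IsNoetherian.noetherian p
  obtain ⟨tI, htI⟩ := IsNoetherian.noetherian I
  rw [ass_iff, ass_iff]
  constructor
  · rintro ⟨-, h, hh⟩
    refine ⟨hp, ?_⟩
    obtain ⟨n, α, rfl⟩ := phi_surj I N i h
    have hIp : I ≤ p := by
      refine hp.le_of_pow_le (n := n) fun r hr => ?_
      rw [hh, ← map_smul, smul_EE_left r (quot_killed (I ^ n) r hr), map_zero]
    obtain ⟨m, hm, h1, h2⟩ := kill_gens I N i n α tI (fun r hr => (hh r).1 (hIp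
      (htI ▸ Submodule.subset_span hr)))
    have h3 := span_kill tI I htI _ h2
    have hmI : I ^ m ≤ I := Ideal.pow_le_self (by omega)
    obtain ⟨s, hs, β, hβ⟩ := lemC I i hC m hmI _ h3
    have hpsi : psi I N i β = s • phi I N i n α := by
      rw [← psi_eq I N i m h1 hmI, hβ, map_smul, phi_compat I N i hm]
    obtain ⟨t, ht, ht2⟩ := exists_common (p := p) tp (fun r => r • β) (fun r hr => by
      apply psi_zero I N i hC
      rw [map_smul, hpsi, smul_comm, (hh r).1 (htp ▸ Submodule.subset_span hr), smul_zero])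
    have ht3 := span_kill tp p htp (t • β) (fun r hr => by rw [smul_comm]; exact ht2 r hr)
    refine ⟨t • β, fun r => ⟨ht3 r, fun hr => ?_⟩⟩
    have h5 := congrArg (psi I N i) hr
    rw [map_smul, map_smul, hpsi, map_zero, smul_smul, smul_smul, ← hh] at h5
    rcases hp.mem_or_mem h5 with h6 | h6
    · exact (hp.mem_or_mem h6).resolve_right ht
    · exact absurd h6 hs
  · rintro ⟨-, β, hβ⟩
    refine ⟨hp, psi I N i β, fun r => ⟨fun hr => ?_, fun hr => ?_⟩⟩
    · rw [← map_smul, (hβ r).1 hr, map_zero]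
    · rw [← map_smul] at hr
      obtain ⟨s, hs, h⟩ := psi_zero I N i hC _ hr
      rw [smul_smul, ← hβ] at h
      exact (hp.mem_or_mem h).resolve_left hs

lemma part1 (i : ℕ) (P : Set (Ideal R))
    (hP : P = ⋃ (j : ℕ) (_ : j < i),
      PrimeSpectrum.asIdeal '' Module.support R ((localCohomology I j).obj (ModuleCat.of R N))) :
    associatedPrimes R ((localCohomology I i).obj (ModuleCat.of R N)) ∪ P =
        associatedPrimes R (extMod i (ModuleCat.of R (R ⧸ I)) (ModuleCat.of R N)) ∪ P := by
  have he : associatedPrimes R (extMod i (ModuleCat.of R (R ⧸ I)) (ModuleCat.of R N)) =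
      associatedPrimes R (EE R (R ⧸ I) N i) :=
    LinearEquiv.AssociatedPrimes.eq (bridge (ModuleCat.of R (R ⧸ I)) (ModuleCat.of R N) i)
  rw [he]
  ext p
  rw [Set.mem_union, Set.mem_union]
  by_cases hpP : p ∈ P
  · simp [hpP]
  simp only [hpP, or_false]
  have key : p.IsPrime → (p ∈ associatedPrimes R (LC I N i) ↔
      p ∈ associatedPrimes R (EE R (R ⧸ I) N i)) := by
    intro hp
    apply ass_of_LC
    intro j hj
    have : (⟨p, hp⟩ : PrimeSpectrum R) ∉ Module.support R (LC I N j) := by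
      intro h
      apply hpP
      rw [hP]
      exact Set.mem_iUnion₂.2 ⟨j, hj, _, h, rfl⟩
    exact Module.notMem_support_iff'.1 this
  exact ⟨fun h => (key ((ass_iff p).1 h).1).1 h, fun h => (key ((ass_iff p).1 h).1).2 h⟩

lemma two_le_dim [IsLocalRing R] {p q : Ideal R} [hq : q.IsPrime] [hp : p.IsPrime] (h1 : q < p)
    (h2 : p < IsLocalRing.maximalIdeal R) : (2 : WithBot ℕ∞) ≤ ringKrullDim (R ⧸ q) := by
  rw [ringKrullDim_quotient]
  let a : PrimeSpectrum.zeroLocus (q : Set R) := ⟨⟨q, hq⟩, le_refl q⟩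
  let b : PrimeSpectrum.zeroLocus (q : Set R) := ⟨⟨p, hp⟩, h1.le⟩
  let c : PrimeSpectrum.zeroLocus (q : Set R) :=
    ⟨⟨IsLocalRing.maximalIdeal R, inferInstance⟩, h1.le.trans h2.le⟩
  have hab : a < b := h1
  have hbc : b < c := h2
  let s : LTSeries (PrimeSpectrum.zeroLocus (q : Set R)) :=
    { length := 2
      toFun := ![a, b, c]
      step := fun k => by
        fin_cases k
        · exact hab
        · exact hbc }
  exact Order.LTSeries.length_le_krullDim s

lemma supp_finite [IsLocalRing R] {M : Type u} [AddCommGroup M] [Module R M] [Module.Finite R M]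
    (h : ∀ p : Ideal R, ∀ _ : p.IsPrime, (2 : WithBot ℕ∞) ≤ ringKrullDim (R ⧸ p) → SZ p M) :
    (Module.support R M).Finite := by
  have hfin : ((Module.annihilator R M).minimalPrimes ∪ {IsLocalRing.maximalIdeal R}).Finite :=
    (Ideal.finite_minimalPrimes_of_isNoetherianRing R _).union (Set.finite_singleton _)
  refine Set.Finite.subset (hfin.preimage
    (Function.Injective.injOn (f := PrimeSpectrum.asIdeal) fun a b => PrimeSpectrum.ext)) ?_
  intro p hps
  have hle : Module.annihilator R M ≤ p.asIdeal := Module.mem_support_iff_of_finite.1 hps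
  obtain ⟨q, hq, hqp⟩ := Ideal.exists_minimalPrimes_le hle
  have hqP : q.IsPrime := hq.1.1
  rcases hqp.eq_or_lt with rfl | hlt
  · exact Or.inl hq
  rcases (IsLocalRing.le_maximalIdeal p.2.ne_top).eq_or_lt with he | hlt2
  · exact Or.inr he
  exfalso
  have hpp := p.2
  have h2 := h q hqP (two_le_dim hlt hlt2)
  refine absurd ?_ (Module.notMem_support_iff' (p := ⟨q, hqP⟩) |>.2 h2)
  exact Module.mem_support_iff_of_finite.2 hq.1.2

lemma exists_seq (M : ModuleCat.{u} R) (r : ℕ) (hr : (r : ℕ∞) = gdepth I M) (l : ℕ) (hl : l < r) :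
    ∃ xs : List R, IsGenRegSeq I M xs ∧ l < xs.length := by
  have : (l : ℕ∞) < gdepth I M := by rw [← hr]; exact_mod_cast hl
  unfold gdepth at this
  obtain ⟨_, ⟨xs, hxs, rfl⟩, h⟩ := lt_sSup_iff.1 this
  exact ⟨xs, hxs, by exact_mod_cast h⟩

lemma part2 [IsLocalRing R] [Module.Finite R N] (r : ℕ)
    (hr : (r : ℕ∞) = gdepth I (ModuleCat.of R N)) :
    (associatedPrimes R ((localCohomology I r).obj (ModuleCat.of R N))).Finite := by
  have hE : ∀ l < r, (Module.support R (EE R (R ⧸ I) N l)).Finite := by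
    intro l hl
    obtain ⟨xs, hxs, hlen⟩ := exists_seq I _ r hr l hl
    apply supp_finite
    intro p hp hd
    exact SZ_genReg I hd xs hxs l hlen
  have hL : ∀ j < r, (Module.support R (LC I N j)).Finite := by
    intro j hj
    refine Set.Finite.subset (Set.Finite.biUnion (Set.finite_Iic j) (fun l hl =>
      hE l (lt_of_le_of_lt hl hj))) ?_
    intro p hp
    by_contra hcon
    have hpp := p.2
    refine absurd hp (Module.notMem_support_iff'.2 (LC_of_C (p := p.asIdeal) I N (j + 1) ?_ j
      (Nat.lt_succ_self j)))
    intro l hl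
    refine (Module.notMem_support_iff' (p := p)).1 fun h => hcon ?_
    exact Set.mem_iUnion₂.2 ⟨l, Nat.lt_succ_iff.1 hl, h⟩
  have h1 := part1 I N r _ rfl
  have he : associatedPrimes R (extMod r (ModuleCat.of R (R ⧸ I)) (ModuleCat.of R N)) =
      associatedPrimes R (EE R (R ⧸ I) N r) :=
    LinearEquiv.AssociatedPrimes.eq (bridge (ModuleCat.of R (R ⧸ I)) (ModuleCat.of R N) r)
  refine Set.Finite.subset (Set.Finite.union ?_ ?_) (Set.subset_union_left.trans h1.subset)
  · rw [he]
    exact associatedPrimes.finite R _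
  · exact Set.Finite.biUnion (Set.finite_Iio r) (fun j hj => (hL j hj).image _)

end Final

end GD

variable {R : Type u} [CommRing R] [IsNoetherianRing R] [IsLocalRing R]

theorem stmt_13 (I : Ideal R) (N : Type u) [AddCommGroup N] [Module R N] [Module.Finite R N] (i : ℕ)
    (P : Set (Ideal R))
    (hP : P = ⋃ (j : ℕ) (_ : j < i),
      PrimeSpectrum.asIdeal '' Module.support R ((localCohomology I j).obj (ModuleCat.of R N))) :
    associatedPrimes R ((localCohomology I i).obj (ModuleCat.of R N)) ∪ P =
        associatedPrimes R (extMod i (ModuleCat.of R (R ⧸ I)) (ModuleCat.of R N)) ∪ P ∧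
      ∀ r : ℕ, (r : ℕ∞) = gdepth I (ModuleCat.of R N) →
        (associatedPrimes R ((localCohomology I r).obj (ModuleCat.of R N))).Finite := by
  exact ⟨GD.part1 I N i P hP, fun r hr => GD.part2 I N r hr⟩

end
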